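/- arXiv:0804.1503 — 5 statements merged into one kernel-verified Lean document; each statement's English description precedes it below -/
import Mathlib

section
/- For every integer n ≥ 1 and d = 3n+1, there exists a unique symmetric ℂ-quadrilinear map Φ : V(d)⁴ → V(4) such that Φ(l₁^d, l₂^d, l₃^d, l₄^d) = I(l₁,l₂,l₃,l₄)^n · l₁l₂l₃l₄ for all linear forms l₁, l₂, l₃, l₄ ∈ ℂ[x₁,x₂,x₃]. -/
open MvPolynomial

noncomputable section

/-- The polynomial ring ℂ[x₁,x₂,x₃]. -/
abbrev MvP : Type := MvPolynomial (Fin 3) ℂ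

/-- The linear form a₁x₁+a₂x₂+a₃x₃ with coefficient vector a. -/
def lin (a : Fin 3 → ℂ) : MvP := ∑ i, C (a i) * X i

lemma lin_hom (a : Fin 3 → ℂ) : (lin a).IsHomogeneous 1 := by
  unfold lin
  apply IsHomogeneous.sum
  intro i _
  simpa using (isHomogeneous_C (Fin 3) (a i)).mul (isHomogeneous_X ℂ i)

/-- V(k): the space of homogeneous polynomials of degree k in ℂ[x₁,x₂,x₃]. -/
def V (k : ℕ) : Submodule ℂ MvP := homogeneousSubmodule (Fin 3) ℂ k

/-- l^d as an element of V(d), where l is the linear form with coefficient vector a. -/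
def powV (d : ℕ) (a : Fin 3 → ℂ) : V d :=
  ⟨lin a ^ d, by rw [V, mem_homogeneousSubmodule]; simpa using (lin_hom a).pow d⟩

/-- The bracket (l₁l₂l₃) = det(vec l₁, vec l₂, vec l₃). -/
def br (a b c : Fin 3 → ℂ) : ℂ := Matrix.det (Matrix.of ![a, b, c])

/-- I(l₁,l₂,l₃,l₄) = (l₁l₂l₃)(l₁l₂l₄)(l₁l₃l₄)(l₂l₃l₄). -/
def Icov (a b c d : Fin 3 → ℂ) : ℂ := br a b c * br a b d * br a c d * br b c d

/-- l₁l₂l₃l₄ as an element of V(4). -/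
def prod4 (a b c d : Fin 3 → ℂ) : V 4 :=
  ⟨lin a * lin b * lin c * lin d, by
    rw [V, mem_homogeneousSubmodule]
    simpa using (((lin_hom a).mul (lin_hom b)).mul (lin_hom c)).mul (lin_hom d)⟩

/-- l₁²l₂²l₃²l₄² as an element of V(8). -/
def prod4sq (a b c d : Fin 3 → ℂ) : V 8 :=
  ⟨lin a ^ 2 * lin b ^ 2 * lin c ^ 2 * lin d ^ 2, by
    rw [V, mem_homogeneousSubmodule]
    simpa using ((((lin_hom a).pow 2).mul ((lin_hom b).pow 2)).mul ((lin_hom c).pow 2)).mul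
      ((lin_hom d).pow 2)⟩

/-- Φ is a Clebsch covariant of degree d = 3n+1: a symmetric quadrilinear map
V(d)⁴ → V(4) with Φ(l₁^d,l₂^d,l₃^d,l₄^d) = I(l₁,l₂,l₃,l₄)^n · l₁l₂l₃l₄. -/
def IsClebschS (n : ℕ) (Φ : MultilinearMap ℂ (fun _ : Fin 4 => V (3*n+1)) (V 4)) : Prop :=
  (∀ (v : Fin 4 → V (3*n+1)) (σ : Equiv.Perm (Fin 4)), Φ (v ∘ σ) = Φ v) ∧
  (∀ a b c d : Fin 3 → ℂ,
    Φ ![powV (3*n+1) a, powV (3*n+1) b, powV (3*n+1) c, powV (3*n+1) d]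
      = (Icov a b c d) ^ n • prod4 a b c d)

/-- Ψ is a Clebsch covariant of degree d = 3n+2: a symmetric quadrilinear map
V(d)⁴ → V(8) with Ψ(l₁^d,l₂^d,l₃^d,l₄^d) = I(l₁,l₂,l₃,l₄)^n · l₁²l₂²l₃²l₄². -/
def IsClebschT (n : ℕ) (Ψ : MultilinearMap ℂ (fun _ : Fin 4 => V (3*n+2)) (V 8)) : Prop :=
  (∀ (v : Fin 4 → V (3*n+2)) (σ : Equiv.Perm (Fin 4)), Ψ (v ∘ σ) = Ψ v) ∧
  (∀ a b c d : Fin 3 → ℂ,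
    Ψ ![powV (3*n+2) a, powV (3*n+2) b, powV (3*n+2) c, powV (3*n+2) d]
      = (Icov a b c d) ^ n • prod4sq a b c d)

/-- Membership in L_S = x₁^{2n+3}·V(n−2): a homogeneous form of degree 3n+1 lies in L_S
iff it is divisible by x₁^{2n+3}. -/
def memLS (n : ℕ) (h : V (3*n+1)) : Prop := (X 0 : MvP) ^ (2*n+3) ∣ (h : MvP)

/-- Membership in L_T = x₁^{2n+5}·V(n−3): a homogeneous form of degree 3n+2 lies in L_T
iff it is divisible by x₁^{2n+5}. -/
def memLT (n : ℕ) (h : V (3*n+2)) : Prop := (X 0 : MvP) ^ (2*n+5) ∣ (h : MvP)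

/-- The Lagrange interpolation polynomial p_i^b of degree K−1 evaluated at c. -/
def interp {K : ℕ} (b : Fin K → ℂ) (i : Fin K) (c : ℂ) : ℂ :=
  ∏ j ∈ Finset.univ.erase i, (c - b j) / (b i - b j)

/-- f(c) = Σᵢ p_i^b(c)·l_i^d − (cx₁+y)^d where y = λx₂+μx₃ and l_i = b_i x₁ + y. -/
def fc {K : ℕ} (d : ℕ) (b : Fin K → ℂ) (lam mu c : ℂ) : MvP :=
  ∑ i, C (interp b i c) * lin ![b i, lam, mu] ^ d - lin ![c, lam, mu] ^ d

/-- f(c) as an element of V(d). -/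
def fcV {K : ℕ} (d : ℕ) (b : Fin K → ℂ) (lam mu c : ℂ) : V d :=
  ∑ i, interp b i c • powV d ![b i, lam, mu] - powV d ![c, lam, mu]

/-- The bracket (l₁l₂l₃) over an arbitrary commutative ring. -/
def brR {R : Type*} [CommRing R] (a b c : Fin 3 → R) : R := Matrix.det (Matrix.of ![a, b, c])

/-- I(l₁,l₂,l₃,l₄) over an arbitrary commutative ring. -/
def IcovR {R : Type*} [CommRing R] (a b c d : Fin 3 → R) : R :=
  brR a b c * brR a b d * brR a c d * brR b c d

/-- The binomial coefficient polynomial X(X−1)⋯(X−m+1)/m! over ℂ. -/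
def binomPoly (m : ℕ) : Polynomial ℂ :=
  Polynomial.C ((m.factorial : ℂ))⁻¹ * ∏ i ∈ Finset.range m, (Polynomial.X - Polynomial.C (i : ℂ))

/-- The mod-p binomial coefficient polynomial X(X−1)⋯(X−m+1)/m!. -/
def binomPolyZMod (p m : ℕ) : Polynomial (ZMod p) :=
  Polynomial.C ((m.factorial : ZMod p))⁻¹ *
    ∏ i ∈ Finset.range m, (Polynomial.X - Polynomial.C (i : ZMod p))

/-- c·x₁ + λx₂ + μx₃ as an element of (ℂ[x₁,x₂,x₃])[c]. -/
def cLin (lam mu : ℂ) : Polynomial MvP :=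
  Polynomial.X * Polynomial.C (X 0) + Polynomial.C (C lam * X 1 + C mu * X 2)

/-- G_n = −24 Σ_{i<k<p} I(cx₁+y, m_i, m_k, m_p)^n·(cx₁+y)·m_i m_k m_p ∈ ℂ[c,x₁,x₂,x₃],
viewed as a polynomial in c with coefficients in ℂ[x₁,x₂,x₃]. -/
def Gpoly {N : ℕ} (m : Fin N → Fin 3 → ℂ) (lam mu : ℂ) (n : ℕ) : Polynomial MvP :=
  (-24 : Polynomial MvP) *
    ∑ i, ∑ k, ∑ p,
      if i < k ∧ k < p then
        Polynomial.map (MvPolynomial.C)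
          ((IcovR ![Polynomial.X, Polynomial.C lam, Polynomial.C mu]
            (fun j => Polynomial.C (m i j)) (fun j => Polynomial.C (m k j))
            (fun j => Polynomial.C (m p j))) ^ n)
        * cLin lam mu * Polynomial.C (lin (m i) * lin (m k) * lin (m p))
      else 0

/-- The nine linear forms m₁,…,m₉ (coefficient vectors). -/
def ms : Fin 9 → Fin 3 → ℂ :=
  ![![1, 3, 9], ![-10, 1, 4], ![8, 4, 6],
    ![1, 6, -10], ![4, -8, -10], ![-3, 7, -4],
    ![0, -3, 2], ![8, -4, -4], ![-10, 4, 6]]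

/-- exponent function to finsupp -/
def ef (m : Fin 3 → ℕ) : Fin 3 →₀ ℕ := Finsupp.equivFunOnFinite.symm m

lemma lin_pow (d : ℕ) (a : Fin 3 → ℂ) :
    lin a ^ d = ∑ k ∈ Finset.piAntidiag Finset.univ d,
      monomial (ef k) ((Nat.multinomial Finset.univ k : ℂ) * ∏ j, a j ^ k j) := by
  unfold lin
  rw [Finset.sum_pow_eq_sum_piAntidiag]
  refine Finset.sum_congr rfl fun k _ => ?_
  rw [monomial_eq, Finsupp.prod_fintype _ _ (by simp)]
  simp only [mul_pow, Finset.prod_mul_distrib, map_mul, map_prod, map_pow, map_natCast, ef,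
    Finsupp.equivFunOnFinite_symm_apply_apply, mul_assoc]

lemma coeff_lin_pow (d : ℕ) (a : Fin 3 → ℂ) (m : Fin 3 → ℕ) (hm : ∑ j, m j = d) :
    coeff (ef m) (lin a ^ d) = (Nat.multinomial Finset.univ m : ℂ) * ∏ j, a j ^ m j := by
  rw [lin_pow, coeff_sum, Finset.sum_eq_single m]
  · simp
  · intro b _ hb
    rw [coeff_monomial, if_neg]
    intro h
    exact hb (Finsupp.equivFunOnFinite.symm.injective h)
  · intro h
    exact absurd (by simp [Finset.mem_piAntidiag, hm]) h

lemma exists_functional (d : ℕ) (m : Fin 3 → ℕ) (hm : ∑ j, m j = d) :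
    ∃ L : V d →ₗ[ℂ] ℂ, ∀ a, L (powV d a) = ∏ j, a j ^ m j := by
  refine ⟨(Nat.multinomial Finset.univ m : ℂ)⁻¹ • (lcoeff ℂ (ef m)).comp (V d).subtype, fun a => ?_⟩
  have : (Nat.multinomial Finset.univ m : ℂ) ≠ 0 := by
    exact_mod_cast (Nat.multinomial_pos _ _).ne'
  simp [powV, coeff_lin_pow d a m hm, this]

lemma span_powV (d : ℕ) : Submodule.span ℂ (Set.range (powV d)) = ⊤ := by
  by_contra hne
  obtain ⟨f, hf, hle⟩ := Submodule.exists_le_ker_of_lt_top _ (lt_top_iff_ne_top.2 hne)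
  apply hf
  obtain ⟨g, hg⟩ := LinearMap.exists_extend f
  have h1 : ∀ a, g (lin a ^ d) = 0 := by
    intro a
    have h2 : powV d a ∈ LinearMap.ker f := hle (Submodule.subset_span ⟨a, rfl⟩)
    rw [LinearMap.mem_ker, ← hg] at h2
    exact h2
  let P : MvP := ∑ k ∈ Finset.piAntidiag Finset.univ d,
      monomial (ef k) ((Nat.multinomial Finset.univ k : ℂ) * g (monomial (ef k) 1))
  have hP : P = 0 := by
    apply MvPolynomial.funext
    intro a
    rw [map_zero, ← h1 a, lin_pow, map_sum, map_sum]
    refine Finset.sum_congr rfl fun k _ => ?_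
    rw [eval_monomial, Finsupp.prod_fintype _ _ (by simp), ← mul_one (_ * ∏ j, a j ^ k j),
      ← smul_eq_mul (_ * ∏ j, a j ^ k j), ← smul_monomial, map_smul]
    simp only [ef, Finsupp.equivFunOnFinite_symm_apply_apply, smul_eq_mul]
    ring
  have h3 : ∀ m : Fin 3 → ℕ, ∑ j, m j = d → g (monomial (ef m) 1) = 0 := by
    intro m hm
    have h4 : coeff (ef m) P = 0 := by rw [hP, coeff_zero]
    rw [coeff_sum, Finset.sum_eq_single m] at h4
    · have : (Nat.multinomial Finset.univ m : ℂ) ≠ 0 := by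
        exact_mod_cast (Nat.multinomial_pos _ _).ne'
      simpa [this] using h4
    · intro b _ hb
      rw [coeff_monomial, if_neg]
      intro h
      exact hb (Finsupp.equivFunOnFinite.symm.injective h)
    · intro h
      exact absurd (by simp [Finset.mem_piAntidiag, hm]) h
  ext ⟨v, hv⟩
  rw [← hg]
  change g v = 0
  rw [V, mem_homogeneousSubmodule] at hv
  rw [v.as_sum, map_sum]
  refine Finset.sum_eq_zero fun m hm => ?_
  rw [← mul_one (coeff m v), ← smul_eq_mul, ← smul_monomial, map_smul]
  have hd := hv (mem_support_iff.1 hm)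
  have := h3 m (by rw [← hd, Finsupp.weight_apply, Finsupp.sum_fintype _ _ (by simp)]; simp)
  have he : ef m = m := by ext; simp [ef]
  rw [he] at this
  rw [this, smul_zero]

lemma multi_ext (d : ℕ) {M : Type*} [AddCommGroup M] [Module ℂ M]
    (F G : MultilinearMap ℂ (fun _ : Fin 4 => V d) M)
    (h : ∀ a : Fin 4 → Fin 3 → ℂ, F (fun i => powV d (a i)) = G (fun i => powV d (a i))) :
    F = G := by
  let B := Module.Basis.ofSpan (span_powV d).ge
  apply Module.Basis.ext_multilinear (fun _ => B)
  intro v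
  have : ∀ i, ∃ a, powV d a = B (v i) := fun i =>
    Module.Basis.ofSpan_subset (span_powV d).ge ⟨v i, rfl⟩
  choose a ha using this
  simp only [← ha]
  exact h a

/-- functions of four vectors with values in polynomials -/
abbrev Fun4 := (Fin 4 → Fin 3 → ℂ) → MvP

/-- multihomogeneous monomials -/
def monS (e : Fin 4 → ℕ) : Set Fun4 :=
  {F | ∃ (m : Fin 4 → Fin 3 → ℕ) (p : MvP), (∀ i, ∑ j, m i j = e i) ∧
    F = fun a => (∏ i, ∏ j, a i j ^ m i j) • p}

/-- multihomogeneous functions -/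
def SS (e : Fin 4 → ℕ) : Submodule ℂ Fun4 := Submodule.span ℂ (monS e)

lemma SS_mul {e e' : Fin 4 → ℕ} {F G : Fun4} (hF : F ∈ SS e) (hG : G ∈ SS e') :
    F * G ∈ SS (e + e') := by
  have h := Submodule.mul_mem_mul hF hG
  rw [SS, SS, Submodule.span_mul_span] at h
  refine Submodule.span_mono ?_ h
  rintro _ ⟨_, ⟨m, p, hm, rfl⟩, _, ⟨m', p', hm', rfl⟩, rfl⟩
  refine ⟨m + m', p * p', fun i => ?_, ?_⟩
  · simp [Finset.sum_add_distrib, hm, hm']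
  · funext a
    simp only [Pi.mul_apply, Pi.add_apply, pow_add, Finset.prod_mul_distrib, smul_mul_smul_comm]

lemma SS_one : (1 : Fun4) ∈ SS 0 := by
  refine Submodule.subset_span ⟨0, 1, by simp, ?_⟩
  funext a
  simp

lemma SS_pow {e : Fin 4 → ℕ} {F : Fun4} (hF : F ∈ SS e) (n : ℕ) : F ^ n ∈ SS (n • e) := by
  induction n with
  | zero => simpa using SS_one
  | succ n ih => rw [pow_succ, succ_nsmul]; exact SS_mul ih hF

lemma SS_coord (i : Fin 4) (j : Fin 3) (p : MvP) : (fun a => a i j • p : Fun4) ∈ SS (Pi.single i 1) := by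
  refine Submodule.subset_span ⟨Pi.single i (Pi.single j 1), p, fun i' => ?_, ?_⟩
  · by_cases h : i' = i
    · subst h; simp
    · simp [h]
  · funext a
    rw [Finset.prod_eq_single i, Finset.prod_eq_single j]
    · simp
    · intro b _ hb; simp [hb]
    · simp
    · intro b _ hb; simp [hb]
    · simp

lemma SS_lin (i : Fin 4) : (fun a => lin (a i) : Fun4) ∈ SS (Pi.single i 1) := by
  have : (fun a => lin (a i) : Fun4) = ∑ j, (fun a => a i j • (X j : MvP) : Fun4) := by
    funext a
    simp [lin, smul_eq_C_mul]
  rw [this]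
  exact Submodule.sum_mem _ fun j _ => SS_coord i j _

lemma SS_br (i j k : Fin 4) : (fun a => C (br (a i) (a j) (a k)) : Fun4) ∈
    SS (Pi.single i 1 + Pi.single j 1 + Pi.single k 1) := by
  have key : ∀ x y z : Fin 3, (fun a => C (a i x * a j y * a k z) : Fun4) ∈
    SS (Pi.single i 1 + Pi.single j 1 + Pi.single k 1) := by
    intro x y z
    have := SS_mul (SS_mul (SS_coord i x 1) (SS_coord j y 1)) (SS_coord k z 1)
    convert this using 1
    funext a
    simp [smul_eq_C_mul]
  have : (fun a => C (br (a i) (a j) (a k)) : Fun4) =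
      (fun a => C (a i 0 * a j 1 * a k 2)) - (fun a => C (a i 0 * a j 2 * a k 1))
      - (fun a => C (a i 1 * a j 0 * a k 2)) + (fun a => C (a i 1 * a j 2 * a k 0))
      + (fun a => C (a i 2 * a j 0 * a k 1)) - (fun a => C (a i 2 * a j 1 * a k 0)) := by
    funext a
    simp only [br, Matrix.det_fin_three, Pi.add_apply, Pi.sub_apply, ← map_sub, ← map_add]
    simp
  rw [this]
  exact Submodule.sub_mem _ (Submodule.add_mem _ (Submodule.add_mem _ (Submodule.sub_mem _
    (Submodule.sub_mem _ (key _ _ _) (key _ _ _)) (key _ _ _)) (key _ _ _)) (key _ _ _)) (key _ _ _)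

lemma SS_real (d : ℕ) {F : Fun4} (hF : F ∈ SS (fun _ => d)) :
    ∃ Φ : MultilinearMap ℂ (fun _ : Fin 4 => V d) MvP,
      ∀ a, Φ (fun i => powV d (a i)) = F a := by
  unfold SS at hF
  induction hF using Submodule.span_induction with
  | mem F h =>
    obtain ⟨m, p, hm, rfl⟩ := h
    choose L hL using fun i => exists_functional d (m i) (hm i)
    refine ⟨((MultilinearMap.mkPiRing ℂ (Fin 4) p).compLinearMap L), fun a => ?_⟩
    simp [hL]
  | zero => exact ⟨0, fun a => rfl⟩
  | add F G _ _ h1 h2 =>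
    obtain ⟨A, hA⟩ := h1
    obtain ⟨B, hB⟩ := h2
    exact ⟨A + B, fun a => by simp [hA, hB]⟩
  | smul c F _ h1 =>
    obtain ⟨A, hA⟩ := h1
    exact ⟨c • A, fun a => by simp [hA]⟩

lemma target_mem (n : ℕ) :
    (fun a => C (Icov (a 0) (a 1) (a 2) (a 3)) ^ n *
      (lin (a 0) * lin (a 1) * lin (a 2) * lin (a 3)) : Fun4) ∈ SS (fun _ => 3*n+1) := by
  have h := SS_mul (SS_pow (SS_mul (SS_mul (SS_mul (SS_br 0 1 2) (SS_br 0 1 3)) (SS_br 0 2 3))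
    (SS_br 1 2 3)) n) (SS_mul (SS_mul (SS_mul (SS_lin 0) (SS_lin 1)) (SS_lin 2)) (SS_lin 3))
  convert h using 1
  · congr 1
    funext i
    fin_cases i <;> simp [Pi.single_apply] <;> ring
  · funext a
    simp only [Icov, map_mul, Pi.mul_apply, Pi.pow_apply]

lemma br_swap (a b c : Fin 3 → ℂ) : br b a c = - br a b c ∧ br a c b = - br a b c := by
  constructor <;> simp [br, Matrix.det_fin_three] <;> ring

/-- the target function -/
def tgt (n : ℕ) (a : Fin 4 → Fin 3 → ℂ) : V 4 :=
  Icov (a 0) (a 1) (a 2) (a 3) ^ n • prod4 (a 0) (a 1) (a 2) (a 3)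

lemma tgt_symm (n : ℕ) (σ : Equiv.Perm (Fin 4)) :
    ∀ a : Fin 4 → Fin 3 → ℂ, tgt n (a ∘ σ) = tgt n a := by
  have hσ : σ ∈ Submonoid.closure
      (Set.range fun i : Fin 3 => Equiv.swap i.castSucc i.succ) := by
    rw [Equiv.Perm.mclosure_swap_castSucc_succ]; trivial
  induction hσ using Submonoid.closure_induction with
  | mem s hs =>
    obtain ⟨i, rfl⟩ := hs
    intro a
    have e1 : ∀ a b c d : Fin 3 → ℂ, Icov b a c d = Icov a b c d := by
      intro a b c d; simp only [Icov, (br_swap a b _).1]; ring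
    have e2 : ∀ a b c d : Fin 3 → ℂ, Icov a c b d = Icov a b c d := by
      intro a b c d; simp only [Icov, (br_swap b c _).1, (br_swap a b c).2]; ring
    have e3 : ∀ a b c d : Fin 3 → ℂ, Icov a b d c = Icov a b c d := by
      intro a b c d; simp only [Icov, (br_swap _ c d).2]; ring
    have p1 : ∀ a b c d : Fin 3 → ℂ, prod4 b a c d = prod4 a b c d := by
      intro a b c d; apply Subtype.ext; simp only [prod4]; ring
    have p2 : ∀ a b c d : Fin 3 → ℂ, prod4 a c b d = prod4 a b c d := by
      intro a b c d; apply Subtype.ext; simp only [prod4]; ring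
    have p3 : ∀ a b c d : Fin 3 → ℂ, prod4 a b d c = prod4 a b c d := by
      intro a b c d; apply Subtype.ext; simp only [prod4]; ring
    fin_cases i
    · change Icov (a 1) (a 0) (a 2) (a 3) ^ n • prod4 (a 1) (a 0) (a 2) (a 3) = _
      rw [e1, p1]; rfl
    · change Icov (a 0) (a 2) (a 1) (a 3) ^ n • prod4 (a 0) (a 2) (a 1) (a 3) = _
      rw [e2, p2]; rfl
    · change Icov (a 0) (a 1) (a 3) (a 2) ^ n • prod4 (a 0) (a 1) (a 3) (a 2) = _
      rw [e3, p3]; rfl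
  | one => intro a; rfl
  | mul s t _ _ h1 h2 =>
    intro a
    rw [Equiv.Perm.coe_mul, ← Function.comp_assoc, h2, h1]

theorem stmt0 (n : ℕ) (hn : 1 ≤ n) :
    ∃! Φ : MultilinearMap ℂ (fun _ : Fin 4 => V (3*n+1)) (V 4),
      (∀ (v : Fin 4 → V (3*n+1)) (σ : Equiv.Perm (Fin 4)), Φ (v ∘ σ) = Φ v) ∧
      (∀ a b c d : Fin 3 → ℂ,
        Φ ![powV (3*n+1) a, powV (3*n+1) b, powV (3*n+1) c, powV (3*n+1) d]
          = (Icov a b c d) ^ n • prod4 a b c d) := by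
  have hvec : ∀ a : Fin 4 → Fin 3 → ℂ, (fun i => powV (3*n+1) (a i)) =
      ![powV (3*n+1) (a 0), powV (3*n+1) (a 1), powV (3*n+1) (a 2), powV (3*n+1) (a 3)] := by
    intro a; funext i; fin_cases i <;> rfl
  obtain ⟨Φ₀, hΦ₀⟩ := SS_real _ (target_mem n)
  obtain ⟨P, hP⟩ := LinearMap.exists_leftInverse_of_injective (V 4).subtype
    (LinearMap.ker_eq_bot.2 (V 4).subtype_injective)
  have hPΦ : ∀ a, P.compMultilinearMap Φ₀ (fun i => powV (3*n+1) (a i)) = tgt n a := by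
    intro a
    rw [LinearMap.compMultilinearMap_apply, hΦ₀]
    have := LinearMap.congr_fun hP (tgt n a)
    rw [LinearMap.comp_apply, LinearMap.id_apply] at this
    rw [← this]
    congr 1
    simp [tgt, prod4, smul_eq_C_mul]
  refine ⟨P.compMultilinearMap Φ₀, ⟨fun v σ => ?_, fun a b c d => ?_⟩, ?_⟩
  · have : (P.compMultilinearMap Φ₀).domDomCongr σ = P.compMultilinearMap Φ₀ := by
      apply multi_ext
      intro a
      rw [hPΦ, ← tgt_symm n σ a, ← hPΦ]
      rfl
    exact DFunLike.congr_fun this v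
  · have := hPΦ ![a, b, c, d]
    rw [hvec] at this
    exact this
  · rintro Ψ ⟨-, h⟩
    apply multi_ext
    intro a
    rw [hPΦ, hvec, h]
    rfl
end
end

section
/- Let n ≥ 2, d = 3n+1, and let Φ be a Clebsch covariant of degree d. If h₃ and h₄ both lie in L_S (i.e. are homogeneous of degree d and divisible by x₁^{2n+3}), then Φ(h₁,h₂,h₃,h₄) = 0 for all h₁, h₂ ∈ V(d). (This expresses that the projectivization of L_S is contained in the base scheme of the rational map S_d : ℙV(d) ⇢ ℙV(4) with a full triple structure.) -/
open MvPolynomial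

noncomputable section

lemma vanish (d : ℕ) (φ : MvP →ₗ[ℂ] ℂ) (h : ∀ a, φ (lin a ^ d) = 0) (f : MvP)
    (hf : f ∈ V d) : φ f = 0 := by
  classical
  have exp : ∀ a : Fin 3 → ℂ, φ (lin a ^ d) = ∑ k ∈ Finset.piAntidiag Finset.univ d,
      (Nat.multinomial Finset.univ k : ℂ) * (∏ i, a i ^ k i) *
        φ (monomial (Finsupp.equivFunOnFinite.symm k) 1) := by
    intro a
    rw [lin, Finset.sum_pow_eq_sum_piAntidiag, map_sum]
    refine Finset.sum_congr rfl fun k _ => ?_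
    rw [← smul_eq_mul (a := (Nat.multinomial Finset.univ k : ℂ) * (∏ i, a i ^ k i)), ← map_smul]
    congr 1
    rw [monomial_eq, smul_eq_C_mul, Finsupp.prod_fintype _ _ (by simp)]
    simp [mul_pow, Finset.prod_mul_distrib, mul_assoc]
  let P : MvP := ∑ k ∈ Finset.piAntidiag Finset.univ d,
      monomial (Finsupp.equivFunOnFinite.symm k) ((Nat.multinomial Finset.univ k : ℂ) *
        φ (monomial (Finsupp.equivFunOnFinite.symm k) 1))
  have hP : P = 0 := by
    apply MvPolynomial.funext
    intro a
    rw [map_zero, ← h a, exp, map_sum]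
    refine Finset.sum_congr rfl fun k _ => ?_
    rw [eval_monomial, Finsupp.prod_fintype _ _ (by simp)]
    simp; ring
  have key : ∀ m : Fin 3 →₀ ℕ, m.degree = d → φ (monomial m 1) = 0 := by
    intro m hm
    have h1 : coeff m P = 0 := by rw [hP]; simp
    simp only [P, coeff_sum, coeff_monomial] at h1
    rw [Finset.sum_eq_single (m : Fin 3 → ℕ)] at h1
    · have : Finsupp.equivFunOnFinite.symm (m : Fin 3 → ℕ) = m := by ext; simp
      rw [this, if_pos rfl] at h1
      refine (mul_eq_zero.1 h1).resolve_left ?_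
      exact_mod_cast (Nat.multinomial_pos _ _).ne'
    · intro k _ hk
      rw [if_neg]
      intro e; apply hk; rw [← e]; ext; simp
    · intro hk
      exfalso; apply hk
      rw [Finset.mem_piAntidiag]
      refine ⟨?_, by simp⟩
      rw [← hm, Finsupp.degree_eq_sum]
  rw [f.as_sum, map_sum]
  refine Finset.sum_eq_zero fun m hm => ?_
  have hd : m.degree = d := by
    rw [V, mem_homogeneousSubmodule] at hf
    have := hf (mem_support_iff.1 hm)
    rw [Finsupp.degree_eq_weight_one]
    exact this
  have : monomial m (coeff m f) = coeff m f • (monomial m 1 : MvP) := by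
    rw [smul_monomial, smul_eq_mul, mul_one]
  rw [this, map_smul, key m hd, smul_zero]

lemma pow_span (d : ℕ) (f : MvP) (hf : f ∈ V d) :
    f ∈ Submodule.span ℂ (Set.range fun a : Fin 3 → ℂ => lin a ^ d) := by
  by_contra hc
  obtain ⟨φ, h1, h2⟩ := Submodule.exists_le_ker_of_notMem hc
  exact h1 (vanish d φ (fun a => h2 (Submodule.subset_span ⟨a, rfl⟩)) f hf)

def tau (t : ℂ) : MvP →ₐ[ℂ] MvP := aeval ![C t * X 0, X 1, X 2]

lemma tau_monomial (t : ℂ) (m : Fin 3 →₀ ℕ) (c : ℂ) :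
    tau t (monomial m c) = t ^ (m 0) • monomial m c := by
  rw [tau, aeval_monomial, monomial_eq, smul_eq_C_mul, Finsupp.prod_fintype _ _ (by simp),
    Finsupp.prod_fintype _ _ (by simp)]
  simp [Fin.prod_univ_three, mul_pow, algebraMap_eq]
  ring

lemma tau_lin (t : ℂ) (a : Fin 3 → ℂ) : tau t (lin a) = lin ![t * a 0, a 1, a 2] := by
  simp [tau, lin, Fin.sum_univ_three, algebraMap_eq]
  ring

/-- the polynomial describing `L (tau t f) (tau t g)` -/
def tpoly (L : MvP →ₗ[ℂ] MvP →ₗ[ℂ] ℂ) (f g : MvP) : Polynomial ℂ :=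
  ∑ m ∈ f.support, ∑ m' ∈ g.support,
    Polynomial.monomial (m 0 + m' 0) (L (monomial m (coeff m f)) (monomial m' (coeff m' g)))

lemma tpoly_eval (L : MvP →ₗ[ℂ] MvP →ₗ[ℂ] ℂ) (f g : MvP) (t : ℂ) :
    (tpoly L f g).eval t = L (tau t f) (tau t g) := by
  conv_rhs => rw [f.as_sum, g.as_sum]
  simp only [tpoly, Polynomial.eval_finsetSum, map_sum, LinearMap.sum_apply,
    Polynomial.eval_monomial, tau_monomial, map_smul, LinearMap.smul_apply, smul_eq_mul, Finset.mul_sum]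
  rw [Finset.sum_comm]
  refine Finset.sum_congr rfl fun m _ => Finset.sum_congr rfl fun m' _ => ?_
  ring

lemma tpoly_dvd (L : MvP →ₗ[ℂ] MvP →ₗ[ℂ] ℂ) (f g : MvP) (k : ℕ)
    (hf : (X 0 : MvP) ^ k ∣ f) (hg : (X 0 : MvP) ^ k ∣ g) :
    (Polynomial.X : Polynomial ℂ) ^ (k + k) ∣ tpoly L f g := by
  have key : ∀ f : MvP, (X 0 : MvP) ^ k ∣ f → ∀ m ∈ f.support, k ≤ m 0 := by
    rintro f ⟨q, rfl⟩ m hm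
    rw [mem_support_iff, X_pow_eq_monomial, coeff_monomial_mul'] at hm
    have h : Finsupp.single 0 k ≤ m := by
      by_contra h
      simp [h] at hm
    simpa using h 0
  refine Finset.dvd_sum fun m hm => Finset.dvd_sum fun m' hm' => ?_
  rw [← Polynomial.C_mul_X_pow_eq_monomial]
  exact Dvd.dvd.mul_left (pow_dvd_pow _ (add_le_add (key f hf m hm) (key g hg m' hm'))) _

lemma core (L : MvP →ₗ[ℂ] MvP →ₗ[ℂ] ℂ) (d N k : ℕ) (hk : N < k + k)
    (hL : ∀ a b : Fin 3 → ℂ, ∃ p : Polynomial ℂ, p.natDegree ≤ N ∧ ∀ t, p.eval t =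
      L (lin ![t * a 0, a 1, a 2] ^ d) (lin ![t * b 0, b 1, b 2] ^ d))
    (f g : MvP) (hf : f ∈ V d) (hg : g ∈ V d)
    (hf' : (X 0 : MvP) ^ k ∣ f) (hg' : (X 0 : MvP) ^ k ∣ g) : L f g = 0 := by
  have step : ∃ p : Polynomial ℂ, p.natDegree ≤ N ∧ ∀ t, p.eval t = L (tau t f) (tau t g) := by
    have h1 := pow_span d f hf
    have h2 := pow_span d g hg
    clear hf hg hf' hg'
    induction h1 using Submodule.span_induction with
    | mem x hx =>
      obtain ⟨a, rfl⟩ := hx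
      induction h2 using Submodule.span_induction with
      | mem y hy =>
        obtain ⟨b, rfl⟩ := hy
        obtain ⟨p, hp, hp'⟩ := hL a b
        exact ⟨p, hp, fun t => by rw [hp']; simp only [map_pow, tau_lin]⟩
      | zero => exact ⟨0, by simp, by simp⟩
      | add x y _ _ hx hy =>
        obtain ⟨p, hp, hp'⟩ := hx
        obtain ⟨q, hq, hq'⟩ := hy
        exact ⟨p + q, Polynomial.natDegree_add_le_of_degree_le hp hq,
          fun t => by rw [Polynomial.eval_add, hp', hq', map_add, map_add]⟩
      | smul c x _ hx =>
        obtain ⟨p, hp, hp'⟩ := hx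
        exact ⟨c • p, (Polynomial.natDegree_smul_le _ _).trans hp,
          fun t => by rw [Polynomial.eval_smul, hp', map_smul, map_smul]⟩
    | zero => exact ⟨0, by simp, by simp⟩
    | add x y _ _ hx hy =>
      obtain ⟨p, hp, hp'⟩ := hx
      obtain ⟨q, hq, hq'⟩ := hy
      exact ⟨p + q, Polynomial.natDegree_add_le_of_degree_le hp hq,
        fun t => by rw [Polynomial.eval_add, hp', hq', map_add, map_add, LinearMap.add_apply]⟩
    | smul c x _ hx =>
      obtain ⟨p, hp, hp'⟩ := hx
      exact ⟨c • p, (Polynomial.natDegree_smul_le _ _).trans hp,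
        fun t => by rw [Polynomial.eval_smul, hp', map_smul, map_smul, LinearMap.smul_apply]⟩
  obtain ⟨p, hp, hp'⟩ := step
  have e : p = tpoly L f g := Polynomial.funext fun t => by rw [hp', tpoly_eval]
  have hz : p = 0 := by
    refine Polynomial.eq_zero_of_dvd_of_natDegree_lt (e ▸ tpoly_dvd L f g k hf' hg') ?_
    rw [Polynomial.natDegree_X_pow]; omega
  have h1 := hp' 1
  have t1 : tau 1 = AlgHom.id ℂ MvP := by
    apply MvPolynomial.algHom_ext
    intro i
    fin_cases i <;> simp [tau]
  rw [hz, t1] at h1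
  simpa using h1.symm

/-- homogeneous component as a map to V d -/
def hcV (d : ℕ) : MvP →ₗ[ℂ] V d :=
  (homogeneousComponent d).codRestrict (V d) (fun f => homogeneousComponent_mem d f)

lemma hcV_coe (d : ℕ) (v : V d) : hcV d v = v := by
  apply Subtype.ext
  have := homogeneousComponent_of_mem (m := d) (n := d) (p := (v : MvP)) v.2
  rw [if_pos rfl] at this
  exact this

lemma hcV_pow (d : ℕ) (a : Fin 3 → ℂ) : hcV d (lin a ^ d) = powV d a :=
  hcV_coe d (powV d a)

def cf (m : Fin 3 →₀ ℕ) (k : ℕ) : V k →ₗ[ℂ] ℂ := (lcoeff ℂ m) ∘ₗ (V k).subtype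

lemma cf_ext (v : V 4) (h : ∀ m, cf m 4 v = 0) : v = 0 := by
  apply Subtype.ext
  apply MvPolynomial.ext
  intro m
  rw [ZeroMemClass.coe_zero, coeff_zero]
  exact h m

lemma upd0 {α : Type*} (a b c d x : α) : Function.update ![a, b, c, d] 0 x = ![x, b, c, d] := by
  ext i; fin_cases i <;> rfl
lemma upd1 {α : Type*} (a b c d x : α) : Function.update ![a, b, c, d] 1 x = ![a, x, c, d] := by
  ext i; fin_cases i <;> rfl
lemma upd2 {α : Type*} (a b c d x : α) : Function.update ![a, b, c, d] 2 x = ![a, b, x, d] := by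
  ext i; fin_cases i <;> rfl
lemma upd3 {α : Type*} (a b c d x : α) : Function.update ![a, b, c, d] 3 x = ![a, b, c, x] := by
  ext i; fin_cases i <;> rfl

def bil {d : ℕ} (Φ : MultilinearMap ℂ (fun _ : Fin 4 => V d) (V 4)) (m : Fin 3 →₀ ℕ) (A B : V d) :
    MvP →ₗ[ℂ] MvP →ₗ[ℂ] ℂ :=
  LinearMap.mk₂ ℂ (fun f g => cf m 4 (Φ ![A, B, hcV d f, hcV d g]))
    (fun f f' g => by
      have := Φ.map_update_add ![A, B, 0, hcV d g] 2 (hcV d f) (hcV d f')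
      simp only [upd2] at this
      rw [map_add, this, map_add])
    (fun c f g => by
      have := Φ.map_update_smul ![A, B, 0, hcV d g] 2 c (hcV d f)
      simp only [upd2] at this
      rw [map_smul, this, map_smul])
    (fun f g g' => by
      have := Φ.map_update_add ![A, B, hcV d f, 0] 3 (hcV d g) (hcV d g')
      simp only [upd3] at this
      rw [map_add, this, map_add])
    (fun c f g => by
      have := Φ.map_update_smul ![A, B, hcV d f, 0] 3 c (hcV d g)
      simp only [upd3] at this
      rw [map_smul, this, map_smul])

lemma br_poly (a b c : Fin 3 → ℂ) : ∃ p : Polynomial ℂ, p.natDegree ≤ 1 ∧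
    ∀ t, p.eval t = br a b ![t * c 0, c 1, c 2] := by
  refine ⟨Polynomial.C (c 0 * (a 1 * b 2 - a 2 * b 1)) * Polynomial.X +
    Polynomial.C (br a b ![0, c 1, c 2]), Polynomial.natDegree_linear_le, fun t => ?_⟩
  simp [br, Matrix.det_fin_three]
  ring

lemma br_poly2 (a b c : Fin 3 → ℂ) : ∃ p : Polynomial ℂ, p.natDegree ≤ 1 ∧
    ∀ t, p.eval t = br a ![t * b 0, b 1, b 2] ![t * c 0, c 1, c 2] := by
  refine ⟨Polynomial.C (- a 1 * (b 0 * c 2 - b 2 * c 0) + a 2 * (b 0 * c 1 - b 1 * c 0)) *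
    Polynomial.X +
    Polynomial.C (br a ![0, b 1, b 2] ![0, c 1, c 2]), Polynomial.natDegree_linear_le, fun t => ?_⟩
  simp [br, Matrix.det_fin_three]
  ring

lemma prod_poly (m : Fin 3 →₀ ℕ) (a b c d : Fin 3 → ℂ) : ∃ p : Polynomial ℂ, p.natDegree ≤ 2 ∧
    ∀ t, p.eval t = cf m 4 (prod4 a b ![t * c 0, c 1, c 2] ![t * d 0, d 1, d 2]) := by
  have hl : ∀ (t : ℂ) (c : Fin 3 → ℂ), lin ![t * c 0, c 1, c 2] =
      C t * lin ![c 0, 0, 0] + lin ![0, c 1, c 2] := by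
    intro t c
    simp [lin, Fin.sum_univ_three]
    ring
  refine ⟨Polynomial.C (coeff m (lin a * lin b * lin ![c 0, 0, 0] * lin ![d 0, 0, 0])) *
      Polynomial.X ^ 2 +
    Polynomial.C (coeff m (lin a * lin b * lin ![c 0, 0, 0] * lin ![0, d 1, d 2] +
      lin a * lin b * lin ![0, c 1, c 2] * lin ![d 0, 0, 0])) * Polynomial.X +
    Polynomial.C (coeff m (lin a * lin b * lin ![0, c 1, c 2] * lin ![0, d 1, d 2])),
    Polynomial.natDegree_quadratic_le, fun t => ?_⟩
  have : cf m 4 (prod4 a b ![t * c 0, c 1, c 2] ![t * d 0, d 1, d 2]) =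
      coeff m (lin a * lin b * lin ![t * c 0, c 1, c 2] * lin ![t * d 0, d 1, d 2]) := rfl
  rw [this, hl, hl]
  have e : lin a * lin b * (C t * lin ![c 0, 0, 0] + lin ![0, c 1, c 2]) *
      (C t * lin ![d 0, 0, 0] + lin ![0, d 1, d 2]) =
      C (t ^ 2) * (lin a * lin b * lin ![c 0, 0, 0] * lin ![d 0, 0, 0]) +
      C t * (lin a * lin b * lin ![c 0, 0, 0] * lin ![0, d 1, d 2] +
        lin a * lin b * lin ![0, c 1, c 2] * lin ![d 0, 0, 0]) +
      lin a * lin b * lin ![0, c 1, c 2] * lin ![0, d 1, d 2] := by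
    rw [C_pow]; ring
  rw [e]
  simp only [coeff_add, coeff_C_mul]
  simp only [Polynomial.eval_add, Polynomial.eval_mul, Polynomial.eval_C, Polynomial.eval_pow,
    Polynomial.eval_X]
  ring

theorem stmt6 (n : ℕ) (hn : 2 ≤ n)
    (Φ : MultilinearMap ℂ (fun _ : Fin 4 => V (3*n+1)) (V 4)) (hΦ : IsClebschS n Φ)
    (h₃ h₄ : V (3*n+1)) (h₃S : memLS n h₃) (h₄S : memLS n h₄) :
    ∀ h₁ h₂ : V (3*n+1), Φ ![h₁, h₂, h₃, h₄] = 0 := by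
  intro h₁ h₂
  have pp : ∀ a b, Φ ![powV _ a, powV _ b, h₃, h₄] = 0 := by
    intro a b
    refine cf_ext _ fun m => ?_
    have := core (bil Φ m (powV _ a) (powV _ b)) (3*n+1) (4*n+2) (2*n+3) (by omega) ?_
      h₃ h₄ h₃.2 h₄.2 h₃S h₄S
    · simpa only [bil, LinearMap.mk₂_apply, hcV_coe] using this
    · intro c e
      obtain ⟨p₁, d₁, e₁⟩ := br_poly a b c
      obtain ⟨p₂, d₂, e₂⟩ := br_poly a b e
      obtain ⟨p₃, d₃, e₃⟩ := br_poly2 a c e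
      obtain ⟨p₄, d₄, e₄⟩ := br_poly2 b c e
      obtain ⟨q, dq, eq⟩ := prod_poly m a b c e
      refine ⟨(p₁ * p₂ * p₃ * p₄) ^ n * q, ?_, fun t => ?_⟩
      · refine Polynomial.natDegree_mul_le.trans ?_
        have h4 : (p₁ * p₂ * p₃ * p₄).natDegree ≤ 4 := by
          have u1 := Polynomial.natDegree_mul_le (p := p₁ * p₂ * p₃) (q := p₄)
          have u2 := Polynomial.natDegree_mul_le (p := p₁ * p₂) (q := p₃)
          have u3 := Polynomial.natDegree_mul_le (p := p₁) (q := p₂)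
          omega
        have h5 := Polynomial.natDegree_pow_le_of_le n h4
        omega
      · simp only [bil, LinearMap.mk₂_apply, hcV_pow]
        rw [hΦ.2, map_smul, smul_eq_mul, Icov, ← e₁, ← e₂, ← e₃, ← e₄, ← eq]
        simp
  have ph : ∀ a, Φ ![powV _ a, h₂, h₃, h₄] = 0 := by
    intro a
    refine cf_ext _ fun m => ?_
    have := vanish (3*n+1)
      (cf m 4 ∘ₗ Φ.toLinearMap ![powV _ a, 0, h₃, h₄] 1 ∘ₗ hcV (3*n+1)) ?_ h₂ h₂.2
    · simpa only [LinearMap.comp_apply, MultilinearMap.toLinearMap_apply, hcV_coe, upd1] using this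
    · intro b
      simp only [LinearMap.comp_apply, MultilinearMap.toLinearMap_apply, hcV_pow, upd1, pp, map_zero]
  refine cf_ext _ fun m => ?_
  have := vanish (3*n+1)
    (cf m 4 ∘ₗ Φ.toLinearMap ![0, h₂, h₃, h₄] 0 ∘ₗ hcV (3*n+1)) ?_ h₁ h₁.2
  · simpa only [LinearMap.comp_apply, MultilinearMap.toLinearMap_apply, hcV_coe, upd0] using this
  · intro b
    simp only [LinearMap.comp_apply, MultilinearMap.toLinearMap_apply, hcV_pow, upd0, ph, map_zero]
end
end

section
/- Let n ≥ 3, d = 3n+2, let Ψ be a Clebsch covariant of degree d, and let g ∈ V(d). Then for every h ∈ L_T one has Ψ(h+g, h+g, h+g, h+g) = 4·Ψ(h,g,g,g) + Ψ(g,g,g,g); in particular the map h ↦ Ψ(h+g,h+g,h+g,h+g) is affine-linear on L_T (this is the linearity of the restriction of T_d to ℙ(L_T + ℂg)). -/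
open MvPolynomial

noncomputable section

abbrev JJ (d : ℕ) : Type := {α : Fin 3 → ℕ // α ∈ Finset.piAntidiag (Finset.univ : Finset (Fin 3)) d}

def WB (i j : Fin 4) (k : ℕ) (p : MvPolynomial (Fin 4 × Fin 3) ℂ) : Prop :=
  ∀ s, p.coeff s ≠ 0 → s (i, 0) + s (j, 0) ≤ k

lemma WB.mul {i j : Fin 4} {k l : ℕ} {p q : MvPolynomial (Fin 4 × Fin 3) ℂ}
    (hp : WB i j k p) (hq : WB i j l q) : WB i j (k + l) (p * q) := by
  intro s hs
  rw [coeff_mul] at hs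
  obtain ⟨x, hx, hne⟩ := Finset.exists_ne_zero_of_sum_ne_zero hs
  have h1 := hp _ (left_ne_zero_of_mul hne)
  have h2 := hq _ (right_ne_zero_of_mul hne)
  rw [Finset.HasAntidiagonal.mem_antidiagonal] at hx
  rw [← hx]
  simp only [Finsupp.add_apply]
  omega

lemma WB.add {i j : Fin 4} {k : ℕ} {p q : MvPolynomial (Fin 4 × Fin 3) ℂ}
    (hp : WB i j k p) (hq : WB i j k q) : WB i j k (p + q) := by
  intro s hs
  rw [coeff_add] at hs
  by_cases h : p.coeff s = 0
  · exact hq s (by simpa [h] using hs)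
  · exact hp s h

lemma WB.sub {i j : Fin 4} {k : ℕ} {p q : MvPolynomial (Fin 4 × Fin 3) ℂ}
    (hp : WB i j k p) (hq : WB i j k q) : WB i j k (p - q) := by
  intro s hs
  rw [coeff_sub] at hs
  by_cases h : p.coeff s = 0
  · exact hq s (by simpa [h] using hs)
  · exact hp s h

lemma WB.C' {i j : Fin 4} (c : ℂ) : WB i j 0 (C c) := by
  intro s hs
  rw [coeff_C] at hs
  have : s = 0 := by
    by_contra h
    exact hs (if_neg (fun h' => h h'.symm))
  simp [this]

lemma WB.pow {i j : Fin 4} {k : ℕ} {p : MvPolynomial (Fin 4 × Fin 3) ℂ}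
    (hp : WB i j k p) (m : ℕ) : WB i j (m * k) (p ^ m) := by
  induction m with
  | zero => simpa using WB.C' (i := i) (j := j) 1
  | succ m ih =>
    rw [pow_succ, Nat.succ_mul]
    exact ih.mul hp

lemma WB.X0 {i j : Fin 4} (hij : i ≠ j) (a : Fin 4) : WB i j 1 (X (a, 0)) := by
  intro s hs
  rw [coeff_X] at hs
  have : s = Finsupp.single (a, 0) 1 := by
    by_contra h
    exact hs (if_neg (fun h' => h h'.symm))
  subst this
  simp only [Finsupp.single_apply, Prod.mk.injEq, and_true]
  split_ifs with h1 h2 <;> simp_all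

lemma WB.X1 {i j : Fin 4} (a : Fin 4) (b : Fin 3) (hb : b ≠ 0) : WB i j 0 (X (a, b)) := by
  intro s hs
  rw [coeff_X] at hs
  have : s = Finsupp.single (a, b) 1 := by
    by_contra h
    exact hs (if_neg (fun h' => h h'.symm))
  subst this
  simp [Finsupp.single_apply, hb]

def rowX (a : Fin 4) : Fin 3 → MvPolynomial (Fin 4 × Fin 3) ℂ := fun b => X (a, b)

lemma WB.br {i j : Fin 4} (hij : i ≠ j) (a b c : Fin 4) :
    WB i j 1 (brR (rowX a) (rowX b) (rowX c)) := by
  have h0 : ∀ a, WB i j 1 (X (a, 0)) := WB.X0 hij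
  have h1 : ∀ a, WB i j 0 (X (a, 1)) := fun a => WB.X1 a 1 (by decide)
  have h2 : ∀ a, WB i j 0 (X (a, 2)) := fun a => WB.X1 a 2 (by decide)
  simp only [brR, Matrix.det_fin_three, Matrix.of_apply, rowX, Matrix.cons_val]
  refine WB.sub (WB.add (WB.add (WB.sub (WB.sub ?_ ?_) ?_) ?_) ?_) ?_
  · exact ((h0 _).mul (h1 _)).mul (h2 _)
  · exact ((h0 _).mul (h2 _)).mul (h1 _)
  · exact ((h1 _).mul (h0 _)).mul (h2 _)
  · exact ((h1 _).mul (h2 _)).mul (h0 _)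
  · exact ((h2 _).mul (h0 _)).mul (h1 _)
  · exact ((h2 _).mul (h1 _)).mul (h0 _)

def linX (x : Fin 3 → ℂ) (a : Fin 4) : MvPolynomial (Fin 4 × Fin 3) ℂ :=
  X (a, 0) * C (x 0) + C (x 1) * X (a, 1) + C (x 2) * X (a, 2)

lemma WB.mono {i j : Fin 4} {k l : ℕ} {p : MvPolynomial (Fin 4 × Fin 3) ℂ}
    (hp : WB i j k p) (h : k ≤ l) : WB i j l p := fun s hs => (hp s hs).trans h

lemma WB.lin {i j : Fin 4} (hij : i ≠ j) (x : Fin 3 → ℂ) (a : Fin 4) :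
    WB i j 1 (linX x a) := by
  refine WB.add (WB.add ((WB.X0 hij a).mul (WB.C' _)) ?_) ?_
  · exact ((WB.C' _).mul (WB.X1 a 1 (by decide))).mono (by omega)
  · exact ((WB.C' _).mul (WB.X1 a 2 (by decide))).mono (by omega)

def QQ (n : ℕ) (x : Fin 3 → ℂ) : MvPolynomial (Fin 4 × Fin 3) ℂ :=
  (IcovR (rowX 0) (rowX 1) (rowX 2) (rowX 3)) ^ n *
    (linX x 0 ^ 2 * linX x 1 ^ 2 * linX x 2 ^ 2 * linX x 3 ^ 2)

lemma WB.QQ {i j : Fin 4} (hij : i ≠ j) (n : ℕ) (x : Fin 3 → ℂ) :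
    WB i j (4 * n + 8) (QQ n x) := by
  have h1 := (((WB.br hij 0 1 2).mul (WB.br hij 0 1 3)).mul (WB.br hij 0 2 3)).mul
    (WB.br hij 1 2 3)
  have h2 := ((((WB.lin hij x 0).pow 2).mul ((WB.lin hij x 1).pow 2)).mul
    ((WB.lin hij x 2).pow 2)).mul ((WB.lin hij x 3).pow 2)
  exact ((h1.pow n).mul h2).mono (by omega)

lemma eval_QQ (n : ℕ) (x : Fin 3 → ℂ) (A : Fin 4 × Fin 3 → ℂ) :
    eval A (QQ n x) = eval x ((Icov (fun b => A (0, b)) (fun b => A (1, b)) (fun b => A (2, b))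
      (fun b => A (3, b)) ^ n • prod4sq (fun b => A (0, b)) (fun b => A (1, b))
      (fun b => A (2, b)) (fun b => A (3, b)) : V 8) : MvP) := by
  simp only [QQ, IcovR, brR, Icov, br, prod4sq, linX, rowX, lin, Matrix.det_fin_three,
    Matrix.of_apply, Matrix.cons_val, map_mul, map_pow, map_add, map_sub, eval_X, eval_C,
    Submodule.coe_smul, smul_eval, Fin.sum_univ_three]
  ring

def fs (α : Fin 3 → ℕ) : Fin 3 →₀ ℕ := Finsupp.equivFunOnFinite.symm α

def monoV (d : ℕ) (α : JJ d) : V d :=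
  ⟨monomial (fs α.1) 1, by
    rw [V, mem_homogeneousSubmodule]
    apply isHomogeneous_monomial
    have := α.2
    rw [Finset.mem_piAntidiag] at this
    rw [Finsupp.degree_eq_sum]
    exact this.1⟩

lemma V_expand (d : ℕ) (v : V d) : v = ∑ α : JJ d, coeff (fs α.1) (v : MvP) • monoV d α := by
  apply Subtype.ext
  rw [Submodule.coe_sum]
  ext s
  rw [coeff_sum]
  simp only [Submodule.coe_smul, coeff_smul, monoV, coeff_monomial, smul_eq_mul, mul_ite, mul_one,
    mul_zero]
  have hv : (v : MvP).IsHomogeneous d := (mem_homogeneousSubmodule d _).1 v.2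
  by_cases hs : s.degree = d
  · rw [Finset.sum_eq_single (⟨⇑s, by
      rw [Finset.mem_piAntidiag]
      refine ⟨by rw [← hs, Finsupp.degree_eq_sum], by simp⟩⟩ : JJ d)]
    · have : fs ⇑s = s := by ext; simp [fs]
      simp [this]
    · intro b _ hb
      rw [if_neg]
      rintro rfl
      apply hb
      apply Subtype.ext
      simp [fs]
    · simp
  · rw [hv.coeff_eq_zero hs, Finset.sum_eq_zero]
    intro b _
    rw [if_neg]
    rintro rfl
    apply hs
    have := b.2
    rw [Finset.mem_piAntidiag] at this
    rw [Finsupp.degree_eq_sum]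
    exact this.1

lemma powV_expand (d : ℕ) (a : Fin 3 → ℂ) : powV d a =
    ∑ α : JJ d, ((Nat.multinomial Finset.univ α.1 : ℂ) * ∏ i, a i ^ α.1 i) • monoV d α := by
  apply Subtype.ext
  rw [Submodule.coe_sum]
  change lin a ^ d = _
  rw [lin, Finset.sum_pow_eq_sum_piAntidiag, ← Finset.sum_coe_sort]
  refine Finset.sum_congr rfl fun α _ => ?_
  have : (monomial (fs α.1) (1 : ℂ) : MvP) = ∏ i, X i ^ α.1 i := by
    rw [monomial_eq, Finsupp.prod_fintype _ _ (by simp)]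
    simp [fs]
  simp only [Submodule.coe_smul, monoV, this, smul_eq_C_mul, mul_pow, Finset.prod_mul_distrib,
    map_mul, map_prod, map_pow, map_natCast]
  ring

def bigS {d : ℕ} (r : Fin 4 → JJ d) : Fin 4 × Fin 3 →₀ ℕ :=
  Finsupp.equivFunOnFinite.symm fun p => (r p.1).1 p.2

lemma bigS_inj {d : ℕ} : Function.Injective (bigS (d := d)) := by
  intro r s h
  funext i
  apply Subtype.ext
  funext b
  simpa [bigS] using DFunLike.congr_fun h (i, b)

lemma mono_zero (n : ℕ)
    (Ψ : MultilinearMap ℂ (fun _ : Fin 4 => V (3*n+2)) (V 8)) (hΨ : IsClebschT n Ψ)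
    (r : Fin 4 → JJ (3*n+2)) (i j : Fin 4) (hij : i ≠ j)
    (hr : 4 * n + 8 < (r i).1 0 + (r j).1 0) :
    Ψ (fun k => monoV _ (r k)) = 0 := by
  apply Subtype.ext
  apply MvPolynomial.funext
  intro x
  let P : MvPolynomial (Fin 4 × Fin 3) ℂ := ∑ s : Fin 4 → JJ (3*n+2),
    monomial (bigS s) ((∏ k, (Nat.multinomial Finset.univ (s k).1 : ℂ)) *
      eval x (Ψ (fun k => monoV _ (s k)) : MvP))
  have hPQ : P = QQ n x := by
    apply MvPolynomial.funext
    intro A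
    rw [eval_QQ, ← hΨ.2]
    have e : ![powV (3*n+2) (fun b => A (0, b)), powV (3*n+2) (fun b => A (1, b)),
        powV (3*n+2) (fun b => A (2, b)), powV (3*n+2) (fun b => A (3, b))]
        = fun k => powV (3*n+2) (fun b => A (k, b)) := by
      funext k
      fin_cases k <;> rfl
    rw [e]
    simp_rw [powV_expand]
    rw [MultilinearMap.map_sum, Submodule.coe_sum, map_sum, map_sum]
    refine Finset.sum_congr rfl fun s _ => ?_
    rw [MultilinearMap.map_smul_univ, Submodule.coe_smul, smul_eval, eval_monomial,
      Finsupp.prod_fintype _ _ (by simp), Fintype.prod_prod_type, Finset.prod_mul_distrib]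
    simp only [bigS, Finsupp.equivFunOnFinite_symm_apply_apply]
    ring
  have hc : coeff (bigS r) P = (∏ k, (Nat.multinomial Finset.univ (r k).1 : ℂ)) *
      eval x (Ψ (fun k => monoV _ (r k)) : MvP) := by
    simp only [P, coeff_sum, coeff_monomial, bigS_inj.eq_iff]
    simp
  have hz : coeff (bigS r) P = 0 := by
    rw [hPQ]
    by_contra h
    have := WB.QQ hij n x _ h
    simp only [bigS, Finsupp.equivFunOnFinite_symm_apply_apply] at this
    omega
  rw [hz] at hc
  rcases mul_eq_zero.1 hc.symm with h | h
  · exfalso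
    rw [Finset.prod_eq_zero_iff] at h
    obtain ⟨k, _, hk⟩ := h
    exact (Nat.multinomial_pos _ _).ne' (by exact_mod_cast hk)
  · simpa using h

lemma coeff_zero_of_memLT (n : ℕ) (h : V (3*n+2)) (hh : memLT n h) (s : Fin 3 →₀ ℕ)
    (hs : coeff s (h : MvP) ≠ 0) : 2 * n + 5 ≤ s 0 := by
  obtain ⟨q, hq⟩ := hh
  rw [hq, X_pow_eq_monomial, coeff_monomial_mul'] at hs
  by_contra hlt
  apply hs
  rw [if_neg]
  intro hle
  have := hle 0
  simp at this
  omega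

lemma Psi_zero (n : ℕ)
    (Ψ : MultilinearMap ℂ (fun _ : Fin 4 => V (3*n+2)) (V 8)) (hΨ : IsClebschT n Ψ)
    (v : Fin 4 → V (3*n+2)) (i j : Fin 4) (hij : i ≠ j)
    (hi : memLT n (v i)) (hj : memLT n (v j)) : Ψ v = 0 := by
  have e : v = fun k => ∑ α : JJ (3*n+2), coeff (fs α.1) (v k : MvP) • monoV _ α :=
    funext fun k => V_expand _ _
  rw [e, MultilinearMap.map_sum]
  refine Finset.sum_eq_zero fun r _ => ?_
  rw [MultilinearMap.map_smul_univ]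
  by_cases h1 : coeff (fs (r i).1) (v i : MvP) = 0
  · rw [Finset.prod_eq_zero (Finset.mem_univ i) h1, zero_smul]
  by_cases h2 : coeff (fs (r j).1) (v j : MvP) = 0
  · rw [Finset.prod_eq_zero (Finset.mem_univ j) h2, zero_smul]
  have h1 := coeff_zero_of_memLT n _ hi _ h1
  have h2 := coeff_zero_of_memLT n _ hj _ h2
  simp only [fs, Finsupp.equivFunOnFinite_symm_apply_apply] at h1 h2
  rw [mono_zero n Ψ hΨ r i j hij (by omega), smul_zero]

theorem stmt9 (n : ℕ) (hn : 3 ≤ n)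
    (Ψ : MultilinearMap ℂ (fun _ : Fin 4 => V (3*n+2)) (V 8)) (hΨ : IsClebschT n Ψ)
    (g : V (3*n+2)) :
    ∀ h : V (3*n+2), memLT n h →
      Ψ ![h + g, h + g, h + g, h + g]
        = (4 : ℂ) • Ψ ![h, g, g, g] + Ψ ![g, g, g, g] := by
  intro h hh
  have e0 : ∀ a b c d e, Ψ ![a + b, c, d, e] = Ψ ![a, c, d, e] + Ψ ![b, c, d, e] := by
    intro a b c d e
    have := Ψ.map_update_add ![a, c, d, e] 0 a b
    have u : ∀ z, Function.update ![a, c, d, e] 0 z = ![z, c, d, e] := by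
      intro z; funext k; fin_cases k <;> rfl
    simpa only [u] using this
  have e1 : ∀ a b c d e, Ψ ![c, a + b, d, e] = Ψ ![c, a, d, e] + Ψ ![c, b, d, e] := by
    intro a b c d e
    have := Ψ.map_update_add ![c, a, d, e] 1 a b
    have u : ∀ z, Function.update ![c, a, d, e] 1 z = ![c, z, d, e] := by
      intro z; funext k; fin_cases k <;> rfl
    simpa only [u] using this
  have e2 : ∀ a b c d e, Ψ ![c, d, a + b, e] = Ψ ![c, d, a, e] + Ψ ![c, d, b, e] := by
    intro a b c d e
    have := Ψ.map_update_add ![c, d, a, e] 2 a b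
    have u : ∀ z, Function.update ![c, d, a, e] 2 z = ![c, d, z, e] := by
      intro z; funext k; fin_cases k <;> rfl
    simpa only [u] using this
  have e3 : ∀ a b c d e, Ψ ![c, d, e, a + b] = Ψ ![c, d, e, a] + Ψ ![c, d, e, b] := by
    intro a b c d e
    have := Ψ.map_update_add ![c, d, e, a] 3 a b
    have u : ∀ z, Function.update ![c, d, e, a] 3 z = ![c, d, e, z] := by
      intro z; funext k; fin_cases k <;> rfl
    simpa only [u] using this
  have z01 : ∀ a b, Ψ ![h, h, a, b] = 0 := fun a b =>
    Psi_zero n Ψ hΨ _ 0 1 (by decide) hh hh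
  have z02 : ∀ a b, Ψ ![h, a, h, b] = 0 := fun a b =>
    Psi_zero n Ψ hΨ _ 0 2 (by decide) hh hh
  have z03 : ∀ a b, Ψ ![h, a, b, h] = 0 := fun a b =>
    Psi_zero n Ψ hΨ _ 0 3 (by decide) hh hh
  have z12 : ∀ a b, Ψ ![a, h, h, b] = 0 := fun a b =>
    Psi_zero n Ψ hΨ _ 1 2 (by decide) hh hh
  have z13 : ∀ a b, Ψ ![a, h, b, h] = 0 := fun a b =>
    Psi_zero n Ψ hΨ _ 1 3 (by decide) hh hh
  have z23 : ∀ a b, Ψ ![a, b, h, h] = 0 := fun a b =>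
    Psi_zero n Ψ hΨ _ 2 3 (by decide) hh hh
  have s1 : Ψ ![g, h, g, g] = Ψ ![h, g, g, g] := by
    rw [← hΨ.1 _ (Equiv.swap 0 1)]
    congr 1; funext k; fin_cases k <;> rfl
  have s2 : Ψ ![g, g, h, g] = Ψ ![h, g, g, g] := by
    rw [← hΨ.1 _ (Equiv.swap 0 2)]
    congr 1; funext k; fin_cases k <;> rfl
  have s3 : Ψ ![g, g, g, h] = Ψ ![h, g, g, g] := by
    rw [← hΨ.1 _ (Equiv.swap 0 3)]
    congr 1; funext k; fin_cases k <;> rfl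
  simp only [e0, e1, e2, e3, z01, z02, z03, z12, z13, z23, s1, s2, s3]
  module
end
end

section
/- Let K and d be positive integers with d > K, let b₁,…,b_K ∈ ℂ be pairwise distinct, let (λ,μ) ∈ ℂ² with (λ,μ) ≠ (0,0), set y := λx₂+μx₃ and l_i := b_i x₁ + y for i = 1,…,K. Then for every c ∈ ℂ with c ≠ b_i for all i, the polynomial f(c) := p₁^b(c)·l₁^d + … + p_K^b(c)·l_K^d − (c x₁ + y)^d ∈ ℂ[x₁,x₂,x₃] is nonzero and divisible by x₁^K. -/
open MvPolynomial

noncomputable section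

lemma interp_sum {K : ℕ} (b : Fin K → ℂ) (hb : Function.Injective b) (c : ℂ)
    (p : Polynomial ℂ) (hp : p.degree < K) :
    ∑ i, interp b i c * p.eval (b i) = p.eval c := by
  have h := Lagrange.eq_interpolate (s := Finset.univ) (v := b) (f := p) hb.injOn (by simpa using hp)
  conv_rhs => rw [h]
  rw [Lagrange.interpolate_apply, Polynomial.eval_finsetSum]
  refine Finset.sum_congr rfl fun i _ => ?_
  rw [Polynomial.eval_mul, Polynomial.eval_C, mul_comm]
  congr 1
  rw [Lagrange.basis, Polynomial.eval_prod, interp]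
  refine Finset.prod_congr rfl fun j _ => ?_
  simp [Lagrange.basisDivisor, div_eq_inv_mul]

def errMoment {K : ℕ} (b : Fin K → ℂ) (c : ℂ) (m : ℕ) : ℂ := ∑ i, interp b i c * b i ^ m - c ^ m

lemma em_lt {K : ℕ} (b : Fin K → ℂ) (hb : Function.Injective b) (c : ℂ) (m : ℕ) (hm : m < K) :
    errMoment b c m = 0 := by
  have h := interp_sum b hb c (Polynomial.X ^ m) (by
    rw [Polynomial.degree_X_pow]; exact_mod_cast hm)
  simp only [Polynomial.eval_pow, Polynomial.eval_X] at h
  rw [errMoment, h, sub_self]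

lemma em_K {K : ℕ} (b : Fin K → ℂ) (hb : Function.Injective b) (c : ℂ)
    (hc : ∀ i, c ≠ b i) : errMoment b c K ≠ 0 := by
  have hmon : (Lagrange.nodal Finset.univ b).Monic := Lagrange.nodal_monic
  have hdeg : (Lagrange.nodal Finset.univ b).degree = (K : WithBot ℕ) := by
    simp [Lagrange.degree_nodal]
  have h := interp_sum b hb c (Polynomial.X ^ K - Lagrange.nodal Finset.univ b) (by
    have := Polynomial.degree_sub_lt_left (p := (Polynomial.X ^ K : Polynomial ℂ))
      (q := Lagrange.nodal Finset.univ b) (by rw [hdeg, Polynomial.degree_X_pow])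
      (Polynomial.monic_X_pow K).ne_zero (by
        rw [hmon.leadingCoeff, (Polynomial.monic_X_pow K).leadingCoeff])
    rwa [Polynomial.degree_X_pow] at this)
  simp only [Polynomial.eval_sub, Polynomial.eval_pow, Polynomial.eval_X] at h
  have h2 : ∀ i, (Lagrange.nodal Finset.univ b).eval (b i) = 0 := fun i =>
    Lagrange.eval_nodal_at_node (Finset.mem_univ i)
  simp only [h2, sub_zero] at h
  rw [errMoment, h]
  have : (Lagrange.nodal Finset.univ b).eval c ≠ 0 := by
    rw [Lagrange.eval_nodal, Finset.prod_ne_zero_iff]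
    intro i _
    exact sub_ne_zero.2 (hc i)
  simpa using this

lemma lin_pow_s10 (d : ℕ) (t lam mu : ℂ) : lin ![t, lam, mu] ^ d =
    ∑ m ∈ Finset.range (d + 1), C (t ^ m) *
      (X 0 ^ m * (C lam * X 1 + C mu * X 2) ^ (d - m) * (d.choose m : MvP)) := by
  have : lin ![t, lam, mu] = C t * X 0 + (C lam * X 1 + C mu * X 2) := by
    simp [lin, Fin.sum_univ_three, add_assoc]
  rw [this, add_pow]
  refine Finset.sum_congr rfl fun m _ => ?_
  rw [mul_pow, C_pow]; ring

lemma fc_eq {K : ℕ} (d : ℕ) (b : Fin K → ℂ) (lam mu c : ℂ) : fc d b lam mu c =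
    ∑ m ∈ Finset.range (d + 1), C (errMoment b c m) *
      (X 0 ^ m * (C lam * X 1 + C mu * X 2) ^ (d - m) * (d.choose m : MvP)) := by
  simp only [fc, lin_pow_s10, Finset.mul_sum]
  rw [Finset.sum_comm, ← Finset.sum_sub_distrib]
  refine Finset.sum_congr rfl fun m _ => ?_
  rw [errMoment, C_sub, map_sum, sub_mul, Finset.sum_mul]
  congr 1
  refine Finset.sum_congr rfl fun i _ => ?_
  rw [C_mul]; ring

theorem stmt10 (K d : ℕ) (hK : 1 ≤ K) (hd : K < d)
    (b : Fin K → ℂ) (hb : Function.Injective b)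
    (lam mu : ℂ) (hlm : (lam, mu) ≠ (0, 0))
    (c : ℂ) (hc : ∀ i, c ≠ b i) :
    fc d b lam mu c ≠ 0 ∧ (X 0 : MvP) ^ K ∣ fc d b lam mu c := by
  constructor
  · intro h0
    obtain ⟨u, v, huv⟩ : ∃ u v : ℂ, lam * u + mu * v = 1 := by
      by_cases hl : lam = 0
      · have hm : mu ≠ 0 := fun h => hlm (by rw [hl, h])
        exact ⟨0, mu⁻¹, by simp [hm]⟩
      · exact ⟨lam⁻¹, 0, by simp [hl]⟩
    rw [fc_eq] at h0
    have h1 := congrArg (aeval (R := ℂ)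
      ![(Polynomial.X : Polynomial ℂ), Polynomial.C u, Polynomial.C v]) h0
    have h3 : (Polynomial.C lam * Polynomial.C u + Polynomial.C mu * Polynomial.C v)
        = (1 : Polynomial ℂ) := by
      rw [← Polynomial.C_mul, ← Polynomial.C_mul, ← Polynomial.C_add, huv, Polynomial.C_1]
    simp only [map_sum, map_mul, map_pow, map_add, map_natCast, map_zero, aeval_X, aeval_C,
      Matrix.cons_val_zero, Matrix.cons_val_one, Matrix.cons_val,
      Polynomial.algebraMap_eq, h3, one_pow, mul_one] at h1
    have h2 := congrArg (fun p => Polynomial.coeff p K) h1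
    simp only [Polynomial.finsetSum_coeff, Polynomial.coeff_C_mul, Polynomial.coeff_zero,
      Polynomial.coeff_mul_natCast, Polynomial.coeff_X_pow] at h2
    rw [Finset.sum_eq_single K] at h2
    · have := em_K b hb c hc
      have h4 : (d.choose K : ℂ) ≠ 0 := by exact_mod_cast (Nat.choose_pos hd.le).ne'
      simp [this, h4] at h2
    · intro m _ hm
      simp [hm.symm]
    · intro h
      exact absurd (Finset.mem_range.2 (by omega)) h
  · rw [fc_eq]
    refine Finset.dvd_sum fun m _ => ?_
    by_cases hm : m < K
    · rw [em_lt b hb c m hm]; simp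
    · rw [mul_assoc]
      exact ((pow_dvd_pow _ (not_lt.1 hm)).mul_right _).mul_left _
end
end

section
/- Let n ≥ 3, d = 3n+1, K = 2n+3, let Φ be a Clebsch covariant of degree d, let g ∈ V(d), and let f(c) be as in the context (built from pairwise distinct b₁,…,b_K and y = λx₂+μx₃ with (λ,μ) ≠ (0,0)). Then there exist Q₀,…,Q_d ∈ V(4) such that Φ(f(c)+g, f(c)+g, f(c)+g, f(c)+g) = Σ_{i=0}^d Q_i c^i for all c ∈ ℂ, and every Q_i lies in the ℂ-linear span of the set {Φ(h,g,g,g) : h ∈ L_S} ∪ {Φ(g,g,g,g)}. (Thus each [Q_i] lies in the image of S_d restricted to ℙ(L_S + ℂg).) -/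
open MvPolynomial

noncomputable section

theorem lin_split (b lam mu : ℂ) :
    lin ![b, lam, mu] = b • lin ![1,0,0] + lin ![0,lam,mu] := by
  simp [lin, Fin.sum_univ_three, MvPolynomial.smul_eq_C_mul]; ring

theorem span_pow (d : ℕ) (L : V d →ₗ[ℂ] ℂ) (h : ∀ a, L (powV d a) = 0) : L = 0 := by
  classical
  -- extended functional on all polynomials
  obtain ⟨M, hM⟩ := LinearMap.exists_extend L
  have hM' : ∀ v : V d, L v = M v := fun v => by rw [← hM]; rfl
  have key : ∀ a : Fin 3 → ℂ, lin a ^ d = ∑ k ∈ Finset.piAntidiag Finset.univ d,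
      ((Nat.multinomial Finset.univ k : ℂ) * ∏ i, a i ^ k i) •
        monomial (Finsupp.equivFunOnFinite.symm k) (1:ℂ) := by
    intro a
    rw [lin, Finset.sum_pow_eq_sum_piAntidiag]
    refine Finset.sum_congr rfl fun k _ => ?_
    rw [MvPolynomial.smul_eq_C_mul, monomial_eq]
    simp only [mul_pow, Finset.prod_mul_distrib, map_mul, map_natCast, map_prod, map_pow, map_one,
      one_mul]
    rw [Finsupp.prod_fintype _ _ (by simp)]
    simp [mul_assoc]
  have pz : (∑ k ∈ Finset.piAntidiag Finset.univ d,
      monomial (Finsupp.equivFunOnFinite.symm k) ((Nat.multinomial Finset.univ k : ℂ) *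
        M (monomial (Finsupp.equivFunOnFinite.symm k) (1:ℂ)))
      : MvPolynomial (Fin 3) ℂ) = 0 := by
    apply MvPolynomial.funext
    intro a
    have := h a
    rw [hM', show ((powV d a : V d) : MvP) = lin a ^ d from rfl, key a, map_sum] at this
    rw [map_sum, map_zero, ← this]
    refine Finset.sum_congr rfl fun k _ => ?_
    rw [eval_monomial, map_smul, Finsupp.prod_fintype _ _ (by simp)]
    simp; ring
  have mz : ∀ m : Fin 3 →₀ ℕ, m.degree = d → M (monomial m (1:ℂ)) = 0 := by
    intro m hm
    have := congrArg (coeff m) pz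
    rw [coeff_sum, Finset.sum_eq_single (Finsupp.equivFunOnFinite m)] at this
    · simp only [Equiv.symm_apply_apply, coeff_monomial, if_true, coeff_zero, mul_eq_zero] at this
      rcases this with h1 | h1
      · exact absurd h1 (by exact_mod_cast (Nat.multinomial_pos _ _).ne')
      · exact h1
    · intro k _ hk
      rw [coeff_monomial, if_neg]
      rintro rfl
      exact hk (by simp)
    · intro hk
      exfalso; apply hk
      rw [Finset.mem_piAntidiag]
      refine ⟨?_, by simp⟩
      rw [← hm, Finsupp.degree_eq_sum]; rfl
  ext v
  rw [hM', (v : MvP).as_sum, map_sum]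
  refine Finset.sum_eq_zero fun m hm => ?_
  have hv : (v : MvP).IsHomogeneous d := v.2
  have : monomial m (coeff m (v : MvP)) = coeff m (v : MvP) • monomial m (1:ℂ) := by
    simp [smul_monomial]
  rw [this, map_smul, mz m, smul_zero]
  have h2 := hv (mem_support_iff.mp hm)
  rw [Finsupp.degree_eq_weight_one]; exact h2

theorem span_pow' (d : ℕ) {W : Type*} [AddCommGroup W] [Module ℂ W] (L : V d →ₗ[ℂ] W)
    (h : ∀ a, L (powV d a) = 0) (u : V d) : L u = 0 := by
  rw [← Module.forall_dual_apply_eq_zero_iff ℂ]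
  intro ψ
  have := span_pow d (ψ.comp L) (fun a => by simp [h a])
  exact LinearMap.congr_fun this u

/-- x₁^k y^(d-k) -/
def hk (d : ℕ) (lam mu : ℂ) (k : Fin (d+1)) : V d :=
  ⟨lin ![1,0,0] ^ (k:ℕ) * lin ![0,lam,mu] ^ (d - k), by
    rw [V, mem_homogeneousSubmodule]
    have := ((lin_hom ![1,0,0]).pow (k:ℕ)).mul ((lin_hom ![0,lam,mu]).pow (d-k))
    have e : 1 * (k:ℕ) + 1 * (d - k) = d := by have := k.2; omega
    rwa [e] at this⟩

theorem powV_eq (d : ℕ) (b lam mu : ℂ) : powV d ![b,lam,mu] =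
    ∑ k : Fin (d+1), (b ^ (k:ℕ) * (d.choose k : ℂ)) • hk d lam mu k := by
  apply Subtype.ext
  simp only [powV, hk, Submodule.coe_sum, Submodule.coe_smul]
  rw [lin_split, add_pow, Fin.sum_univ_eq_sum_range
    (fun k => (b ^ k * (d.choose k : ℂ)) • (lin ![1,0,0] ^ k * lin ![0,lam,mu] ^ (d - k)))]
  refine Finset.sum_congr rfl fun k _ => ?_
  simp only [MvPolynomial.smul_eq_C_mul, map_mul, map_pow, map_natCast]
  ring

theorem prod4_split (b b' lam mu : ℂ) (m m' : Fin 3 → ℂ) :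
    prod4 ![b,lam,mu] ![b',lam,mu] m m' =
      (b*b') • prod4 ![1,0,0] ![1,0,0] m m' + b • prod4 ![1,0,0] ![0,lam,mu] m m'
      + b' • prod4 ![0,lam,mu] ![1,0,0] m m' + prod4 ![0,lam,mu] ![0,lam,mu] m m' := by
  apply Subtype.ext
  simp only [prod4, Submodule.coe_add, Submodule.coe_smul]
  rw [lin_split b, lin_split b']
  simp only [MvPolynomial.smul_eq_C_mul, map_mul]
  ring

theorem br1 (b b' lam mu : ℂ) (m : Fin 3 → ℂ) :
    br ![b,lam,mu] ![b',lam,mu] m = (b - b') * br ![1,0,0] ![0,lam,mu] m := by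
  simp [br, Matrix.det_fin_three]; ring

theorem br2 (b lam mu : ℂ) (m m' : Fin 3 → ℂ) :
    br ![b,lam,mu] m m' = b * br ![1,0,0] m m' + br ![0,lam,mu] m m' := by
  simp [br, Matrix.det_fin_three]; ring

section
variable {n : ℕ} (Φ : MultilinearMap ℂ (fun _ : Fin 4 => V (3*n+1)) (V 4))

def T0 (v w z : V (3*n+1)) : V (3*n+1) →ₗ[ℂ] V 4 := Φ.toLinearMap ![0,v,w,z] 0

theorem T0_apply (u v w z : V (3*n+1)) : T0 Φ v w z u = Φ ![u,v,w,z] := by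
  simp only [T0, MultilinearMap.toLinearMap_apply]
  congr 1; ext i; fin_cases i <;> rfl

variable {Φ} (hΦ : IsClebschS n Φ)
include hΦ

theorem sw01 (u v w z : V (3*n+1)) : Φ ![u,v,w,z] = Φ ![v,u,w,z] := by
  rw [← hΦ.1 ![v,u,w,z] (Equiv.swap 0 1)]
  congr 1; ext i; fin_cases i <;> rfl
theorem sw02 (u v w z : V (3*n+1)) : Φ ![u,v,w,z] = Φ ![w,v,u,z] := by
  rw [← hΦ.1 ![w,v,u,z] (Equiv.swap 0 2)]
  congr 1; ext i; fin_cases i <;> rfl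
theorem sw03 (u v w z : V (3*n+1)) : Φ ![u,v,w,z] = Φ ![z,v,w,u] := by
  rw [← hΦ.1 ![z,v,w,u] (Equiv.swap 0 3)]
  congr 1; ext i; fin_cases i <;> rfl

theorem lemB (lam mu : ℂ) (k k' : Fin (3*n+1+1)) (h : 4*n+2 < (k:ℕ) + k') (m m' : Fin 3 → ℂ) :
    Φ ![hk _ lam mu k, hk _ lam mu k', powV _ m, powV _ m'] = 0 := by
  classical
  rw [← Module.forall_dual_apply_eq_zero_iff ℂ]
  intro ψ
  let c : Fin (3*n+1+1) → Fin (3*n+1+1) → ℂ := fun i j =>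
    ψ (Φ ![hk _ lam mu i, hk _ lam mu j, powV _ m, powV _ m'])
  let ex : ℕ → ℕ → (Fin 2 →₀ ℕ) := fun i j => Finsupp.equivFunOnFinite.symm ![i,j]
  have hex : ∀ i j i' j', ex i j = ex i' j' → i = i' ∧ j = j' := by
    intro i j i' j' h
    have h0 := DFunLike.congr_fun h 0
    have h1 := DFunLike.congr_fun h 1
    exact ⟨by simpa [ex] using h0, by simpa [ex] using h1⟩
  let P : MvPolynomial (Fin 2) ℂ := ∑ i : Fin (3*n+1+1), ∑ j : Fin (3*n+1+1),
    monomial (ex i j) (((3*n+1).choose i : ℂ) * ((3*n+1).choose j : ℂ) * c i j)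
  let D1 := br ![1,0,0] ![0,lam,mu] m
  let D2 := br ![1,0,0] ![0,lam,mu] m'
  let E1 := br ![1,0,0] m m'
  let E2 := br ![0,lam,mu] m m'
  let A : MvPolynomial (Fin 2) ℂ := (X 0 - X 1)
  let Q : MvPolynomial (Fin 2) ℂ :=
    (A * C D1 * (A * C D2) * (X 0 * C E1 + C E2) * (X 1 * C E1 + C E2)) ^ n *
    (X 0 * X 1 * C (ψ (prod4 ![1,0,0] ![1,0,0] m m'))
      + X 0 * C (ψ (prod4 ![1,0,0] ![0,lam,mu] m m'))
      + X 1 * C (ψ (prod4 ![0,lam,mu] ![1,0,0] m m'))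
      + C (ψ (prod4 ![0,lam,mu] ![0,lam,mu] m m')))
  have hPQ : P = Q := by
    apply MvPolynomial.funext
    intro x
    have h1 : ψ (Φ ![powV (3*n+1) ![x 0,lam,mu], powV (3*n+1) ![x 1,lam,mu], powV _ m, powV _ m'])
      = eval x P := by
      rw [← T0_apply, powV_eq (3*n+1) (x 0), map_sum, map_sum, map_sum]
      refine Finset.sum_congr rfl fun i _ => ?_
      rw [map_smul, map_smul, T0_apply, sw01 hΦ, ← T0_apply, powV_eq (3*n+1) (x 1), map_sum, map_sum,
        map_sum, Finset.smul_sum]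
      refine Finset.sum_congr rfl fun j _ => ?_
      rw [map_smul, map_smul, T0_apply, sw01 hΦ, eval_monomial, Finsupp.prod_fintype _ _ (by simp)]
      simp [ex, c]; ring
    rw [← h1, hΦ.2, map_smul, prod4_split, Icov, br1, br1, br2 (x 0) lam mu m m', br2 (x 1) lam mu m m']
    simp only [Q, A, D1, D2, E1, E2, map_mul, map_pow, map_add, map_sub, eval_X, eval_C, map_smul,
      smul_eq_mul]
  have hQ : Q.totalDegree ≤ 4*n+2 := by
    have hA : A.totalDegree ≤ 1 := (totalDegree_sub _ _).trans (by simp)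
    have hm : ∀ (p q : MvPolynomial (Fin 2) ℂ) (a b : ℕ), p.totalDegree ≤ a →
      q.totalDegree ≤ b → (p*q).totalDegree ≤ a + b := fun p q a b h1 h2 =>
        (totalDegree_mul p q).trans (add_le_add h1 h2)
    have ha : ∀ (p q : MvPolynomial (Fin 2) ℂ) (a : ℕ), p.totalDegree ≤ a →
      q.totalDegree ≤ a → (p+q).totalDegree ≤ a := fun p q a h1 h2 =>
        (totalDegree_add p q).trans (max_le h1 h2)
    have hC : ∀ (z : ℂ) (a : ℕ), (C z : MvPolynomial (Fin 2) ℂ).totalDegree ≤ a := by simp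
    have hX : ∀ i, (X i : MvPolynomial (Fin 2) ℂ).totalDegree ≤ 1 := by simp
    have hE : ∀ i, (X i * C E1 + C E2 : MvPolynomial (Fin 2) ℂ).totalDegree ≤ 1 := fun i =>
      ha _ _ 1 (hm _ _ 1 0 (hX i) (hC _ _)) (hC _ _)
    have e : 4*n+2 = n*4 + 2 := by ring
    rw [e]
    refine hm _ _ _ _ ((totalDegree_pow _ _).trans (Nat.mul_le_mul_left n ?_)) ?_
    · exact hm _ _ 3 1 (hm _ _ 2 1 (hm _ _ 1 1 (hm _ _ 1 0 hA (hC _ _))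
        (hm _ _ 1 0 hA (hC _ _))) (hE 0)) (hE 1)
    · refine ha _ _ _ (ha _ _ _ (ha _ _ _ ?_ ?_) ?_) (hC _ _)
      · exact hm _ _ 2 0 (hm _ _ 1 1 (hX _) (hX _)) (hC _ _)
      · exact hm _ _ 1 1 (hX _) (hC _ _)
      · exact hm _ _ 1 1 (hX _) (hC _ _)
  have hcf : coeff (ex k k') P = ((3*n+1).choose k : ℂ) * ((3*n+1).choose k' : ℂ) * c k k' := by
    rw [coeff_sum, Finset.sum_eq_single k, coeff_sum, Finset.sum_eq_single k']
    · simp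
    · intro j _ hj
      rw [coeff_monomial, if_neg]
      intro h; exact hj (Fin.ext (hex _ _ _ _ h).2)
    · simp
    · intro i _ hi
      rw [coeff_sum]
      refine Finset.sum_eq_zero fun j _ => ?_
      rw [coeff_monomial, if_neg]
      intro h; exact hi (Fin.ext (hex _ _ _ _ h).1)
    · simp
  have hz : coeff (ex k k') P = 0 := by
    rw [hPQ]
    apply coeff_eq_zero_of_totalDegree_lt
    have : ∑ i ∈ (ex k k').support, ex k k' i = (k:ℕ) + k' := by
      have := Finsupp.degree_eq_sum (ex k k')
      simp only [Finsupp.degree_apply] at this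
      rw [this]; simp [ex]
    omega
  rw [hcf] at hz
  have hp : ∀ i : Fin (3*n+1+1), ((3*n+1).choose i : ℂ) ≠ 0 := fun i => by
    exact_mod_cast (Nat.choose_pos (Nat.lt_succ_iff.mp i.2)).ne'
  rcases mul_eq_zero.mp hz with h1 | h1
  · exact absurd h1 (mul_ne_zero (hp _) (hp _))
  · exact h1

theorem lemC (lam mu : ℂ) (k k' : Fin (3*n+1+1)) (h : 4*n+2 < (k:ℕ) + k') (u v : V (3*n+1)) :
    Φ ![hk _ lam mu k, hk _ lam mu k', u, v] = 0 := by
  rw [sw02 hΦ, ← T0_apply]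
  refine span_pow' _ _ (fun a => ?_) u
  rw [T0_apply, sw03 hΦ, ← T0_apply]
  refine span_pow' _ _ (fun a' => ?_) v
  rw [T0_apply, sw03 hΦ, sw02 hΦ]
  exact lemB hΦ lam mu k k' h a a'

theorem lemD (f g : V (3*n+1)) (hf : ∀ u v, Φ ![f,f,u,v] = 0) :
    Φ ![f+g,f+g,f+g,f+g] = (4:ℂ) • Φ ![f,g,g,g] + Φ ![g,g,g,g] := by
  have a0 : ∀ v w z, Φ ![f+g,v,w,z] = Φ ![f,v,w,z] + Φ ![g,v,w,z] := fun v w z => by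
    simp only [← T0_apply, map_add]
  have a1 : ∀ v w z, Φ ![v,f+g,w,z] = Φ ![v,f,w,z] + Φ ![v,g,w,z] := fun v w z => by
    rw [sw01 hΦ, a0, sw01 hΦ, sw01 hΦ g]
  have a2 : ∀ v w z, Φ ![v,w,f+g,z] = Φ ![v,w,f,z] + Φ ![v,w,g,z] := fun v w z => by
    rw [sw02 hΦ, a0, sw02 hΦ, sw02 hΦ g]
  have a3 : ∀ v w z, Φ ![v,w,z,f+g] = Φ ![v,w,z,f] + Φ ![v,w,z,g] := fun v w z => by
    rw [sw03 hΦ, a0, sw03 hΦ, sw03 hΦ g]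
  have z02 : ∀ u v, Φ ![f,u,f,v] = 0 := fun u v => by
    rw [sw01 hΦ, sw02 hΦ, hf]
  have z03 : ∀ u v, Φ ![f,u,v,f] = 0 := fun u v => by
    rw [sw01 hΦ, sw03 hΦ, hf]
  have z12 : ∀ u v, Φ ![u,f,f,v] = 0 := fun u v => by
    rw [sw02 hΦ, hf]
  have z13 : ∀ u v, Φ ![u,f,v,f] = 0 := fun u v => by
    rw [sw03 hΦ, hf]
  have z23 : ∀ u v, Φ ![u,v,f,f] = 0 := fun u v => by
    rw [sw02 hΦ, z03]
  simp only [a0, a1, a2, a3, hf, z02, z03, z12, z13, z23]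
  rw [sw01 hΦ g f, sw02 hΦ g g f, sw03 hΦ g g g f]
  module
end

theorem interp_eq {K : ℕ} (b : Fin K → ℂ) (i : Fin K) (c : ℂ) :
    interp b i c = (Lagrange.basis Finset.univ b i).eval c := by
  simp only [interp, Lagrange.basis, Lagrange.basisDivisor, Polynomial.eval_prod]
  refine Finset.prod_congr rfl fun j _ => ?_
  simp; ring

/-- coefficient polynomial -/
def Rk {K : ℕ} (d : ℕ) (b : Fin K → ℂ) (k : ℕ) : Polynomial ℂ :=
  Polynomial.C (d.choose k : ℂ) *
    (∑ i, Polynomial.C (b i ^ k) * Lagrange.basis Finset.univ b i - Polynomial.X ^ k)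

theorem fcV_eq {K : ℕ} (d : ℕ) (b : Fin K → ℂ) (lam mu c : ℂ) :
    fcV d b lam mu c = ∑ k : Fin (d+1), (Rk d b k).eval c • hk d lam mu k := by
  simp only [fcV, powV_eq, Finset.smul_sum]
  rw [Finset.sum_comm, ← Finset.sum_sub_distrib]
  refine Finset.sum_congr rfl fun k _ => ?_
  simp only [smul_smul, ← Finset.sum_smul, ← sub_smul, interp_eq, Rk]
  congr 1
  simp only [Polynomial.eval_mul, Polynomial.eval_sub, Polynomial.eval_finsetSum,
    Polynomial.eval_C, Polynomial.eval_pow, Polynomial.eval_X, mul_sub, Finset.mul_sum]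
  congr 1
  · exact Finset.sum_congr rfl fun i _ => by ring
  · ring

theorem Rk_zero {K : ℕ} (d : ℕ) (b : Fin K → ℂ) (hb : Function.Injective b) (k : ℕ) (hk : k < K) :
    Rk d b k = 0 := by
  have := Lagrange.eq_interpolate (s := Finset.univ) (v := b) (f := Polynomial.X ^ k)
    hb.injOn (by simpa using hk)
  rw [Rk]
  rw [Lagrange.interpolate_apply] at this
  simp only [Polynomial.eval_pow, Polynomial.eval_X] at this
  rw [← this]; simp

theorem Rk_deg {K : ℕ} (d : ℕ) (b : Fin K → ℂ) (hb : Function.Injective b) (k : ℕ) (hk : k ≤ d)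
    (hK : K ≤ d + 1) : (Rk d b k).natDegree < d + 1 := by
  rw [Nat.lt_succ_iff]
  refine (Polynomial.natDegree_C_mul_le _ _).trans ?_
  refine (Polynomial.natDegree_sub_le _ _).trans (max_le ?_ (by simpa using hk))
  refine Polynomial.natDegree_sum_le_of_forall_le _ _ fun i _ => ?_
  refine (Polynomial.natDegree_C_mul_le _ _).trans ?_
  have := Lagrange.degree_basis (s := Finset.univ) (v := b) hb.injOn (Finset.mem_univ i)
  rw [Polynomial.natDegree_eq_of_degree_eq_some this]
  simp; omega

theorem stmt11 (n : ℕ) (hn : 3 ≤ n)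
    (Φ : MultilinearMap ℂ (fun _ : Fin 4 => V (3*n+1)) (V 4)) (hΦ : IsClebschS n Φ)
    (g : V (3*n+1))
    (b : Fin (2*n+3) → ℂ) (hb : Function.Injective b)
    (lam mu : ℂ) (hlm : (lam, mu) ≠ (0, 0)) :
    ∃ Q : Fin (3*n+2) → V 4,
      (∀ c : ℂ,
        Φ ![fcV (3*n+1) b lam mu c + g, fcV (3*n+1) b lam mu c + g,
            fcV (3*n+1) b lam mu c + g, fcV (3*n+1) b lam mu c + g]
          = ∑ i : Fin (3*n+2), c ^ (i : ℕ) • Q i) ∧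
      (∀ i : Fin (3*n+2),
        Q i ∈ Submodule.span ℂ
          (((fun h => Φ ![h, g, g, g]) '' {h : V (3*n+1) | memLS n h}) ∪
            {Φ ![g, g, g, g]})) := by
  classical
  have hvan : ∀ c u v, Φ ![fcV (3*n+1) b lam mu c, fcV (3*n+1) b lam mu c, u, v] = 0 := by
    intro c u v
    obtain ⟨w, hw⟩ : ∃ w, w = fcV (3*n+1) b lam mu c := ⟨_, rfl⟩
    suffices h : Φ ![fcV (3*n+1) b lam mu c, w, u, v] = 0 by rwa [hw] at h
    rw [← T0_apply, fcV_eq, map_sum]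
    refine Finset.sum_eq_zero fun k _ => ?_
    rw [map_smul, T0_apply, sw01 hΦ, ← T0_apply, hw, fcV_eq, map_sum]
    by_cases h1 : (k:ℕ) < 2*n+3
    · rw [Rk_zero _ b hb k h1]; simp
    rw [Finset.sum_eq_zero, smul_zero]
    intro k' _
    by_cases h2 : (k':ℕ) < 2*n+3
    · rw [Rk_zero _ b hb k' h2]; simp
    rw [map_smul, T0_apply, lemC hΦ, smul_zero]
    omega
  refine ⟨fun i => (∑ k : Fin (3*n+1+1), (4 * (Rk (3*n+1) b k).coeff i) •
      Φ ![hk _ lam mu k, g, g, g]) + (if (i:ℕ) = 0 then (1:ℂ) else 0) • Φ ![g,g,g,g], ?_, ?_⟩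
  · intro c
    rw [lemD hΦ _ _ (hvan c)]
    simp only [smul_add, Finset.sum_add_distrib]
    congr 1
    · rw [← T0_apply, fcV_eq, map_sum, Finset.smul_sum]
      simp only [Finset.smul_sum]
      rw [Finset.sum_comm]
      refine Finset.sum_congr rfl fun k _ => ?_
      rw [map_smul, T0_apply, Polynomial.eval_eq_sum_range' (Rk_deg (3*n+1) b hb k
        (Nat.lt_succ_iff.mp k.2) (by omega)), ← Fin.sum_univ_eq_sum_range
        (fun i => (Rk (3*n+1) b k).coeff i * c ^ i), Finset.sum_smul, Finset.smul_sum]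
      refine Finset.sum_congr rfl fun i _ => ?_
      module
    · rw [Finset.sum_eq_single (0 : Fin (3*n+2))]
      · simp
      · intro i _ hi
        have hi0 : ¬ ((i:ℕ) = 0) := fun h => hi (Fin.ext h)
        rw [if_neg hi0, zero_smul, smul_zero]
      · simp
  · intro i
    refine Submodule.add_mem _ (Submodule.sum_mem _ fun k _ => ?_)
      (Submodule.smul_mem _ _ (Submodule.subset_span (Or.inr rfl)))
    by_cases h1 : (k:ℕ) < 2*n+3
    · rw [Rk_zero _ b hb k h1]; simp
    refine Submodule.smul_mem _ _ (Submodule.subset_span (Or.inl ⟨_, ?_, rfl⟩))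
    have hl : lin ![1,0,0] = X 0 := by simp [lin, Fin.sum_univ_three]
    show (X 0 : MvP) ^ (2*n+3) ∣ lin ![1,0,0] ^ (k:ℕ) * _
    rw [hl]
    exact Dvd.dvd.mul_right (pow_dvd_pow _ (by omega)) _
end
end
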